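/- arXiv:1205.5465 — 4 statements merged into one kernel-verified Lean document; each statement's English description precedes it below -/
import Mathlib

section
/- Let F be a finite field and n ≥ 1. Let ι be a map from the set of all F-subspaces of F^n to itself such that d_S(ι(U), ι(V)) = d_S(U, V) for all subspaces U, V. Then ι maps the zero subspace either to the zero subspace or to the full space F^n. -/
/-- The subspace distance on the projective geometry `PG(F,n)`:
`d_S(U,V) = dim(U + V) − dim(U ∩ V)`. -/
noncomputable def dS {F : Type*} [Field F] {ι : Type*}
    (U V : Submodule F (ι → F)) : ℕ :=
  Module.finrank F ↥(U ⊔ V) - Module.finrank F ↥(U ⊓ V)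

theorem eq_of_dS_eq_zero {F : Type*} [Field F] {ι : Type*} [Finite ι]
    {U V : Submodule F (ι → F)} (h : dS U V = 0) : U = V := by
  have h' : Module.finrank F ↥(U ⊔ V) ≤ Module.finrank F ↥(U ⊓ V) := Nat.sub_eq_zero_iff_le.mp h
  exact inf_eq_sup.mp (Submodule.eq_of_le_of_finrank_le inf_le_sup h')

theorem dS_self {F : Type*} [Field F] {ι : Type*} (U : Submodule F (ι → F)) : dS U U = 0 := by
  rw [dS, sup_idem, inf_idem, Nat.sub_self]

theorem dS_bot_left {F : Type*} [Field F] {ι : Type*} (U : Submodule F (ι → F)) :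
    dS ⊥ U = Module.finrank F U := by
  rw [dS, bot_sup_eq, bot_inf_eq, finrank_bot, Nat.sub_zero]

theorem dS_eq_of_isCompl {F : Type*} [Field F] {n : ℕ}
    {U V : Submodule F (Fin n → F)} (h : IsCompl U V) : dS U V = n := by
  rw [dS, h.sup_eq_top, h.inf_eq_bot]
  simp

/-- A subspace with at most one complement is trivial. -/
theorem eq_bot_or_eq_top_of_isCompl_unique {K E : Type*} [DivisionRing K] [AddCommGroup E]
    [Module K E] {U : Submodule K E} (h : ∀ V W, IsCompl U V → IsCompl U W → V = W) :
    U = ⊥ ∨ U = ⊤ := by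
  obtain ⟨V, hV⟩ := exists_isCompl U
  have mem_or (x : E) : x ∈ U ∨ x ∈ V := by
    refine or_iff_not_imp_left.mpr fun hx => ?_
    obtain ⟨W, hW, hc⟩ := (Submodule.disjoint_span_singleton_of_notMem hx).symm.exists_isCompl
    rw [h V W hV hc.symm]
    exact hW (Submodule.mem_span_singleton_self x)
  by_contra! hU
  have hV0 : V ≠ ⊥ := by
    rintro rfl
    exact hU.2 (by simpa using hV.sup_eq_top)
  obtain ⟨u, hu, hu0⟩ := Submodule.exists_mem_ne_zero_of_ne_bot hU.1
  obtain ⟨v, hv, hv0⟩ := Submodule.exists_mem_ne_zero_of_ne_bot hV0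
  rcases mem_or (u + v) with huv | huv
  · exact hv0 (Submodule.disjoint_def.mp hV.disjoint v ((U.add_mem_iff_right hu).mp huv) hv)
  · exact hu0 (Submodule.disjoint_def.mp hV.disjoint u hu ((V.add_mem_iff_left hv).mp huv))

/-- Any isometry of `PG(F,n)` with respect to the subspace distance maps the
zero subspace either to the zero subspace or to the full space. -/
theorem stmt0 (F : Type*) [Field F] [Fintype F] (n : ℕ) (hn : 1 ≤ n)
    (ι : Submodule F (Fin n → F) → Submodule F (Fin n → F))
    (hι : ∀ U V : Submodule F (Fin n → F), dS (ι U) (ι V) = dS U V) :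
    ι ⊥ = ⊥ ∨ ι ⊥ = ⊤ := by
  have inj : Function.Injective ι := fun U V h =>
    eq_of_dS_eq_zero (by rw [← hι U V, h, dS_self])
  have surj : Function.Surjective ι := Finite.surjective_of_injective inj
  have eq_image_top (V : Submodule F (Fin n → F)) (hV : IsCompl (ι ⊥) V) : V = ι ⊤ := by
    obtain ⟨W, rfl⟩ := surj V
    have hW : dS ⊥ W = n := by rw [← hι, dS_eq_of_isCompl hV]
    congr 1
    exact Submodule.eq_top_of_finrank_eq (by simpa [dS_bot_left] using hW)
  exact eq_bot_or_eq_top_of_isCompl_unique fun V W hV hW =>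
    (eq_image_top V hV).trans (eq_image_top W hW).symm
end

section
/- Let F be a finite field and n > 2. A map ι : PG(F,n) → PG(F,n) is an order-preserving bijection with respect to the subset relation (i.e., ι is bijective and U ⊆ V if and only if ι(U) ⊆ ι(V), for all subspaces U, V) if and only if ι preserves the subspace distance d_S and maps the zero subspace to the zero subspace. -/
theorem OrderIso.finrank_submodule_eq {K V : Type*} [Field K] [AddCommGroup V] [Module K V]
    [FiniteDimensional K V] (e : Submodule K V ≃o Submodule K V) (U : Submodule K V) :
    Module.finrank K (e U) = Module.finrank K U := by
  have h := Order.height_orderIso e U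
  rw [← Module.length_submodule, ← Module.length_submodule, Module.length_eq_finrank,
    Module.length_eq_finrank] at h
  exact_mod_cast h

section SubspaceDistance

variable {F : Type*} [Field F] {α : Type*} (U V : Submodule F (α → F))

theorem dS_bot_right : dS U ⊥ = Module.finrank F U := by
  rw [dS, sup_bot_eq, inf_bot_eq, finrank_bot, Nat.sub_zero]

variable [Finite α]

theorem dS_add_two_mul_finrank_inf :
    dS U V + 2 * Module.finrank F ↥(U ⊓ V) = Module.finrank F U + Module.finrank F V := by
  have h₁ := Submodule.finrank_sup_add_finrank_inf_eq U V
  have h₂ := Submodule.finrank_mono (inf_le_sup : U ⊓ V ≤ U ⊔ V)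
  unfold dS
  omega

theorem dS_add_finrank_eq_iff_le :
    dS U V + Module.finrank F U = Module.finrank F V ↔ U ≤ V := by
  have h := dS_add_two_mul_finrank_inf U V
  constructor
  · intro hd
    rw [← inf_eq_left]
    exact Submodule.eq_of_le_of_finrank_eq inf_le_left (by omega)
  · intro hle
    rw [inf_eq_left.mpr hle] at h
    omega

end SubspaceDistance

/-- For `n > 2`, a map `ι : PG(F,n) → PG(F,n)` is an order-preserving
bijection (with respect to the subset relation) if and only if it is a
subspace-distance isometry fixing the zero subspace. -/
theorem stmt2 (F : Type*) [Field F] [Fintype F] (n : ℕ) (hn : 2 < n)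
    (ι : Submodule F (Fin n → F) → Submodule F (Fin n → F)) :
    (Function.Bijective ι ∧
      ∀ U V : Submodule F (Fin n → F), U ≤ V ↔ ι U ≤ ι V) ↔
    ((∀ U V : Submodule F (Fin n → F), dS (ι U) (ι V) = dS U V) ∧ ι ⊥ = ⊥) := by
  constructor
  · rintro ⟨hbij, hle⟩
    let e : Submodule F (Fin n → F) ≃o Submodule F (Fin n → F) :=
      ⟨Equiv.ofBijective ι hbij, fun {U V} => (hle U V).symm⟩
    refine ⟨fun U V => ?_, e.map_bot⟩
    change dS (e U) (e V) = dS U V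
    rw [dS, ← e.map_sup, ← e.map_inf, e.finrank_submodule_eq, e.finrank_submodule_eq, dS]
  · rintro ⟨hd, hbot⟩
    have hrank (U : Submodule F (Fin n → F)) : Module.finrank F (ι U) = Module.finrank F U := by
      have h := hd U ⊥
      rwa [hbot, dS_bot_right, dS_bot_right] at h
    have hle (U V : Submodule F (Fin n → F)) : U ≤ V ↔ ι U ≤ ι V := by
      rw [← dS_add_finrank_eq_iff_le U, ← dS_add_finrank_eq_iff_le (ι U), hd, hrank, hrank]
    have hinj : Function.Injective ι := fun U V h =>
      le_antisymm ((hle U V).mpr h.le) ((hle V U).mpr h.ge)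
    exact ⟨Finite.injective_iff_bijective.mp hinj, hle⟩
end

section
/- Let F be a finite field and n > 2. Every map ι : PG(F,n) → PG(F,n) that preserves the subspace distance d_S and satisfies dim(ι(U)) = dim(U) for all subspaces U of F^n is induced by a semilinear transformation: there exist an invertible n×n matrix A over F and a ring automorphism σ of F such that ι(U) = { σ(v·A) : v ∈ U } for every subspace U of F^n. -/
section Span

open Submodule

variable {K V : Type*} [Field K] [AddCommGroup V] [Module K V]

theorem disjoint_span_singleton_of_notMem {u p w : V} (hu : u ∉ K ∙ w) (hp : p ∈ K ∙ w) :
    Disjoint (K ∙ u) (K ∙ p) := by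
  rw [Submodule.disjoint_def]
  intro x hx hx'
  obtain ⟨a, rfl⟩ := mem_span_singleton.1 hx
  by_contra ha
  exact hu ((smul_mem_iff _ (left_ne_zero_of_smul ha)).1
    ((span_singleton_le_iff_mem _ _).2 hp hx'))

/-- A vector in the kernel of a functional and its translate by a vector outside it span
disjoint subspaces. -/
theorem disjoint_span_singleton_add {ℓ : V →ₗ[K] K} {e v : V} (he : ℓ e = 1) (hv : ℓ v = 0) :
    Disjoint (K ∙ v) (K ∙ (e + v)) := by
  rw [Submodule.disjoint_def]
  intro x hx hx'
  obtain ⟨a, rfl⟩ := mem_span_singleton.1 hx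
  obtain ⟨b, hb⟩ := mem_span_singleton.1 hx'
  have h := congrArg ℓ hb
  simp [he, hv] at h
  simp [← hb, h]

end Span

section Projective

open Submodule

variable {K L V W : Type*} [Field K] [Field L] [AddCommGroup V] [Module K V]
  [AddCommGroup W] [Module L W]

/-- `g` lifts the lattice isomorphism `φ` on the kernel of `ℓ`: it is normalised by requiring
`f + g v` to represent the image of the line through `e + v`. -/
structure IsKerLift (φ : Submodule K V ≃o Submodule L W) (ℓ : V →ₗ[K] K) (e : V) (f : W)
    (g : V → W) : Prop where
  apply_eq_one : ℓ e = 1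
  base_mem : f ∈ φ (K ∙ e)
  base_ne_zero : f ≠ 0
  mem : ∀ v, ℓ v = 0 → g v ∈ φ (K ∙ v)
  add_mem : ∀ v, ℓ v = 0 → f + g v ∈ φ (K ∙ (e + v))

theorem OrderIso.exists_isKerLift (φ : Submodule K V ≃o Submodule L W) (ℓ : V →ₗ[K] K) (e : V)
    (he : ℓ e = 1) : ∃ f g, IsKerLift φ ℓ e f g := by
  have he0 : e ≠ 0 := by
    rintro rfl
    simp at he
  obtain ⟨f, hf, hf0⟩ : ∃ f ∈ φ (K ∙ e), f ≠ 0 := by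
    apply Submodule.exists_mem_ne_zero_of_ne_bot
    simpa using he0
  have key : ∀ v : V, ∃ x ∈ φ (K ∙ v), f + x ∈ φ (K ∙ (e + v)) := by
    intro v
    have hle : K ∙ e ≤ (K ∙ (e + v)) ⊔ (K ∙ v) := by
      rw [span_singleton_le_iff_mem, mem_sup]
      exact ⟨e + v, mem_span_singleton_self _, -v, neg_mem (mem_span_singleton_self _), by simp⟩
    have h := φ.monotone hle hf
    rw [φ.map_sup, mem_sup] at h
    obtain ⟨y, hy, z, hz, rfl⟩ := h
    exact ⟨-z, neg_mem hz, by simpa using hy⟩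
  choose g hg hg' using key
  exact ⟨f, g, he, hf, hf0, fun v _ => hg v, fun v _ => hg' v⟩

namespace IsKerLift

variable {φ : Submodule K V ≃o Submodule L W} {ℓ : V →ₗ[K] K} {e : V} {f : W} {g : V → W}

theorem eq_of_mem (h : IsKerLift φ ℓ e f g) {v : V} (hv : ℓ v = 0) {x : W}
    (hx : x ∈ φ (K ∙ v)) (hx' : f + x ∈ φ (K ∙ (e + v))) : g v = x := by
  have hd := (disjoint_span_singleton_add h.apply_eq_one hv).map_orderIso φ
  rw [Submodule.disjoint_def] at hd
  refine sub_eq_zero.1 (hd _ (sub_mem (h.mem v hv) hx) ?_)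
  simpa using sub_mem (h.add_mem v hv) hx'

theorem map_zero (h : IsKerLift φ ℓ e f g) : g 0 = 0 :=
  h.eq_of_mem (_root_.map_zero ℓ) (zero_mem _) (by simpa using h.base_mem)

theorem disjoint_base (h : IsKerLift φ ℓ e f g) {v : V} (hv : ℓ v = 0) :
    Disjoint (φ (K ∙ e)) (φ (K ∙ v)) := by
  apply Disjoint.map_orderIso
  rw [Submodule.disjoint_def]
  intro x hx hx'
  obtain ⟨a, rfl⟩ := mem_span_singleton.1 hx
  obtain ⟨b, hb⟩ := mem_span_singleton.1 hx'
  have hab := congrArg ℓ hb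
  simp [h.apply_eq_one, hv] at hab
  simp [← hab]

theorem ne_zero (h : IsKerLift φ ℓ e f g) {v : V} (hv : ℓ v = 0) (hv0 : v ≠ 0) : g v ≠ 0 := by
  intro h0
  have hd : Disjoint (K ∙ e) (K ∙ (e + v)) := by
    rw [Submodule.disjoint_def]
    intro x hx hx'
    obtain ⟨a, rfl⟩ := mem_span_singleton.1 hx
    obtain ⟨b, hb⟩ := mem_span_singleton.1 hx'
    have hab := congrArg ℓ hb
    simp [h.apply_eq_one, hv] at hab
    subst hab
    have : b = 0 := by simpa [hv0] using hb
    simp [this]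
  have hd' := hd.map_orderIso φ
  rw [Submodule.disjoint_def] at hd'
  exact h.base_ne_zero (hd' f h.base_mem (by simpa [h0] using h.add_mem v hv))

theorem map_span_singleton (h : IsKerLift φ ℓ e f g) {v : V} (hv : ℓ v = 0) (hv0 : v ≠ 0) :
    φ (K ∙ v) = L ∙ g v := by
  have ha : IsAtom (φ (K ∙ v)) := (φ.isAtom_iff _).2 (nonzero_span_atom v hv0)
  refine ((ha.le_iff.1 ((span_singleton_le_iff_mem _ _).2 (h.mem v hv))).resolve_left ?_).symm
  simpa using h.ne_zero hv hv0

theorem map_add_of_disjoint (h : IsKerLift φ ℓ e f g) {v w : V} (hv : ℓ v = 0) (hw : ℓ w = 0)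
    (hd : Disjoint (K ∙ v) (K ∙ w)) : g (v + w) = g v + g w := by
  have h₁ : ((K ∙ (e + v)) ⊔ (K ∙ w)) ⊓ ((K ∙ (e + w)) ⊔ (K ∙ v)) ≤ K ∙ (e + (v + w)) := by
    rintro x ⟨hx, hx'⟩
    obtain ⟨a, b, rfl⟩ := mem_span_pair.1 (by simpa [span_insert] using hx)
    obtain ⟨c, d, hcd⟩ := mem_span_pair.1 (by simpa [span_insert] using hx')
    have hc := congrArg ℓ hcd
    simp [h.apply_eq_one, hv, hw] at hc
    subst hc
    have hcd' : (c - d) • v = (c - b) • w := by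
      rw [← sub_eq_zero] at hcd ⊢
      rw [← neg_eq_zero, ← hcd]
      module
    have hz : (c - d) • v = 0 := by
      rw [Submodule.disjoint_def] at hd
      refine hd _ (smul_mem _ _ (mem_span_singleton_self _)) ?_
      rw [hcd']
      exact smul_mem _ _ (mem_span_singleton_self _)
    rw [hz] at hcd'
    refine mem_span_singleton.2 ⟨c, ?_⟩
    have : b • w = c • w := by
      rw [sub_smul] at hcd'
      exact (sub_eq_zero.1 hcd'.symm).symm
    rw [this]
    module
  have h₂ : ((K ∙ v) ⊔ (K ∙ w)) ⊓ ((K ∙ (e + (v + w))) ⊔ (K ∙ e)) ≤ K ∙ (v + w) := by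
    rintro x ⟨hx, hx'⟩
    obtain ⟨a, b, rfl⟩ := mem_span_pair.1 (by simpa [span_insert] using hx)
    obtain ⟨c, d, hcd⟩ := mem_span_pair.1 (by simpa [span_insert] using hx')
    have hc := congrArg ℓ hcd
    simp [h.apply_eq_one, hv, hw] at hc
    refine mem_span_singleton.2 ⟨c, ?_⟩
    rw [← hcd, eq_neg_of_add_eq_zero_right hc]
    module
  have hmem : f + (g v + g w) ∈ φ (K ∙ (e + (v + w))) := by
    apply φ.monotone h₁
    rw [φ.map_inf, φ.map_sup, φ.map_sup]
    refine ⟨mem_sup.2 ⟨_, h.add_mem v hv, _, h.mem w hw, by abel⟩,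
      mem_sup.2 ⟨_, h.add_mem w hw, _, h.mem v hv, by abel⟩⟩
  refine h.eq_of_mem (by simp [hv, hw]) (φ.monotone h₂ ?_) hmem
  rw [φ.map_inf, φ.map_sup, φ.map_sup]
  exact ⟨mem_sup.2 ⟨_, h.mem v hv, _, h.mem w hw, rfl⟩,
    mem_sup.2 ⟨_, hmem, _, neg_mem h.base_mem, by abel⟩⟩

theorem map_add (h : IsKerLift φ ℓ e f g) (hex : ∀ w : V, ∃ u, ℓ u = 0 ∧ u ∉ K ∙ w)
    {v w : V} (hv : ℓ v = 0) (hw : ℓ w = 0) : g (v + w) = g v + g w := by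
  by_cases hvw : v ∈ K ∙ w
  · obtain ⟨u, hu, huw⟩ := hex w
    have hself := mem_span_singleton_self (R := K) w
    have huv : u + v ∉ K ∙ w := fun hm => huw (by simpa using sub_mem hm hvw)
    have e₁ := h.map_add_of_disjoint (v := u) (w := v + w) hu (by simp [hv, hw])
      (disjoint_span_singleton_of_notMem huw (AddMemClass.add_mem hvw hself))
    have e₂ := h.map_add_of_disjoint (v := u + v) (w := w) (by simp [hu, hv]) hw
      (disjoint_span_singleton_of_notMem huv hself)
    have e₃ := h.map_add_of_disjoint hu hv (disjoint_span_singleton_of_notMem huw hvw)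
    rw [← add_assoc, e₂, e₃, add_assoc] at e₁
    exact (add_left_cancel e₁).symm
  · exact h.map_add_of_disjoint hv hw
      (disjoint_span_singleton_of_notMem hvw (mem_span_singleton_self _))

theorem map_smul_of_disjoint (h : IsKerLift φ ℓ e f g) (hex : ∀ w : V, ∃ u, ℓ u = 0 ∧ u ∉ K ∙ w)
    {v w : V} (hv : ℓ v = 0) (hw : ℓ w = 0) (hv0 : v ≠ 0) (hd : Disjoint (K ∙ v) (K ∙ w))
    {a : K} {s : L} (hs : g (a • v) = s • g v) : g (a • w) = s • g w := by
  by_cases hw0 : w = 0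
  · simp [hw0, h.map_zero]
  have hvw0 : v + w ≠ 0 := by
    intro h0
    rw [Submodule.disjoint_def] at hd
    refine hv0 (hd v (mem_span_singleton_self _) ?_)
    rw [eq_neg_of_add_eq_zero_left h0]
    exact neg_mem (mem_span_singleton_self _)
  have hscale : ∀ x : V, ℓ x = 0 → x ≠ 0 → ∃ t : L, t • g x = g (a • x) := by
    intro x hx hx0
    rw [← mem_span_singleton, ← h.map_span_singleton hx hx0]
    exact φ.monotone (span_singleton_smul_le _ _ _) (h.mem _ (by simp [hx]))
  obtain ⟨t, ht⟩ := hscale w hw hw0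
  obtain ⟨r, hr⟩ := hscale (v + w) (by simp [hv, hw]) hvw0
  rw [smul_add, h.map_add hex hv hw, h.map_add hex (by simp [hv]) (by simp [hw]), hs, ← ht] at hr
  have hd' := hd.map_orderIso φ
  rw [Submodule.disjoint_def] at hd'
  have hrs : (r - s) • g v = (t - r) • g w := by
    rw [← sub_eq_zero] at hr ⊢
    rw [← hr]
    module
  have hz : (r - s) • g v = 0 := hd' _ (smul_mem _ _ (h.mem v hv))
    (hrs ▸ smul_mem _ _ (h.mem w hw))
  have hrs' : r = s := by
    simpa [h.ne_zero hv hv0, sub_eq_zero] using hz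
  have htr : t = r := by
    simpa [hz, h.ne_zero hw hw0, sub_eq_zero] using hrs.symm
  rw [← ht, htr, hrs']

theorem exists_map_smul (h : IsKerLift φ ℓ e f g) (hex : ∀ w : V, ∃ u, ℓ u = 0 ∧ u ∉ K ∙ w)
    (a : K) : ∃ s : L, ∀ v, ℓ v = 0 → g (a • v) = s • g v := by
  obtain ⟨w, hw, hw0⟩ := hex 0
  replace hw0 : w ≠ 0 := by simpa using hw0
  obtain ⟨s, hs⟩ : ∃ s : L, s • g w = g (a • w) := by
    rw [← mem_span_singleton, ← h.map_span_singleton hw hw0]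
    exact φ.monotone (span_singleton_smul_le _ _ _) (h.mem _ (by simp [hw]))
  refine ⟨s, fun v hv => ?_⟩
  by_cases hvw : v ∈ K ∙ w
  · obtain ⟨u, hu, huw⟩ := hex w
    have hu0 : u ≠ 0 := by
      rintro rfl
      exact huw (zero_mem _)
    refine h.map_smul_of_disjoint hex hu hv hu0 (disjoint_span_singleton_of_notMem huw hvw) ?_
    exact h.map_smul_of_disjoint hex hw hu hw0
      (disjoint_span_singleton_of_notMem huw (mem_span_singleton_self _)).symm hs.symm
  · exact h.map_smul_of_disjoint hex hw hv hw0
      (disjoint_span_singleton_of_notMem hvw (mem_span_singleton_self _)).symm hs.symm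

theorem exists_ringHom (h : IsKerLift φ ℓ e f g) (hex : ∀ w : V, ∃ u, ℓ u = 0 ∧ u ∉ K ∙ w) :
    ∃ σ : K →+* L, ∀ a v, ℓ v = 0 → g (a • v) = σ a • g v := by
  choose s hs using h.exists_map_smul hex
  obtain ⟨w, hw, hw0⟩ := hex 0
  replace hw0 : w ≠ 0 := by simpa using hw0
  have hinj := smul_left_injective L (h.ne_zero hw hw0)
  refine ⟨
    { toFun := s
      map_one' := hinj ?_
      map_mul' := fun a b => hinj ?_
      map_zero' := hinj ?_
      map_add' := fun a b => hinj ?_ }, hs⟩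
  · simp [← hs _ w hw]
  · simp only
    rw [← hs _ w hw, mul_smul, hs a _ (by simp [hw]), hs b w hw, mul_smul]
  · simp [← hs _ w hw, h.map_zero]
  · simp only
    rw [← hs _ w hw, add_smul, h.map_add hex (by simp [hw]) (by simp [hw]), hs a w hw, hs b w hw,
      add_smul]

end IsKerLift

/-- The fundamental theorem of projective geometry: a lattice isomorphism between subspace
lattices is induced by an injective semilinear map, when the dimension is at least three. -/
theorem OrderIso.exists_semilinearMap [FiniteDimensional K V] (hV : 2 < Module.finrank K V)
    (φ : Submodule K V ≃o Submodule L W) :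
    ∃ (σ : K →+* L) (G : V →ₛₗ[σ] W), Function.Injective G ∧ ∀ v, G v ∈ φ (K ∙ v) := by
  have : Nontrivial V := Module.nontrivial_of_finrank_pos (R := K) (by lia)
  obtain ⟨e, he0⟩ := exists_ne (0 : V)
  obtain ⟨ℓ, he⟩ := Module.Projective.exists_dual_eq_one K he0
  have hex : ∀ w : V, ∃ u, ℓ u = 0 ∧ u ∉ K ∙ w := by
    intro w
    by_contra! hle
    have h₁ : Module.finrank K (LinearMap.ker ℓ) ≤ 1 :=
      (Submodule.finrank_mono (show LinearMap.ker ℓ ≤ K ∙ w from fun u hu => hle u hu)).trans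
        (by simpa using finrank_span_le_card (R := K) ({w} : Set V))
    have h₂ := LinearMap.finrank_range_add_finrank_ker ℓ
    have h₃ : Module.finrank K (LinearMap.range ℓ) ≤ 1 := by
      simpa using Submodule.finrank_le (LinearMap.range ℓ)
    lia
  obtain ⟨f, g, h⟩ := φ.exists_isKerLift ℓ e he
  obtain ⟨σ, hσ⟩ := h.exists_ringHom hex
  have hker : ∀ v, ℓ (v - ℓ v • e) = 0 := by simp [he]
  let G : V →ₛₗ[σ] W :=
    { toFun := fun v => σ (ℓ v) • f + g (v - ℓ v • e)
      map_add' := fun v w => by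
        have : v + w - ℓ (v + w) • e = (v - ℓ v • e) + (w - ℓ w • e) := by
          rw [_root_.map_add]
          module
        rw [this, h.map_add hex (hker v) (hker w), _root_.map_add, _root_.map_add]
        module
      map_smul' := fun a v => by
        have : a • v - ℓ (a • v) • e = a • (v - ℓ v • e) := by
          rw [_root_.map_smul, smul_eq_mul]
          module
        rw [this, hσ a _ (hker v), _root_.map_smul, smul_eq_mul, _root_.map_mul]
        module }
  have hG : ∀ v, G v = σ (ℓ v) • f + g (v - ℓ v • e) := fun _ => rfl
  refine ⟨σ, G, ?_, fun v => ?_⟩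
  · rw [injective_iff_map_eq_zero]
    intro v hv
    rw [hG] at hv
    have hd := h.disjoint_base (hker v)
    rw [Submodule.disjoint_def] at hd
    have hf : σ (ℓ v) • f = 0 := by
      refine hd _ (smul_mem _ _ h.base_mem) ?_
      rw [eq_neg_of_add_eq_zero_left hv]
      exact neg_mem (h.mem _ (hker v))
    rw [hf, zero_add] at hv
    have hl : ℓ v = 0 := by simpa [h.base_ne_zero] using hf
    by_contra hv0
    exact h.ne_zero (hker v) (by simpa [hl] using hv0) hv
  · rw [hG]
    by_cases hl : ℓ v = 0
    · simpa [hl] using h.mem v hl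
    · have hm := smul_mem _ (σ (ℓ v))
        (h.add_mem ((ℓ v)⁻¹ • (v - ℓ v • e)) (by rw [_root_.map_smul, hker, smul_zero]))
      rw [smul_add, ← hσ _ _ (by rw [_root_.map_smul, hker, smul_zero]),
        smul_inv_smul₀ hl] at hm
      have hv : e + (ℓ v)⁻¹ • (v - ℓ v • e) = (ℓ v)⁻¹ • v := by
        rw [smul_sub, inv_smul_smul₀ hl]
        abel
      rw [hv] at hm
      exact φ.monotone (span_singleton_smul_le _ _ _) hm

theorem OrderIso.coe_eq_image_of_mem (φ : Submodule K V ≃o Submodule L W) {G : V → W}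
    (hG : Function.Surjective G) (hG0 : ∀ v, G v = 0 → v = 0) (hmem : ∀ v, G v ∈ φ (K ∙ v))
    (U : Submodule K V) : (φ U : Set W) = G '' U := by
  ext y
  constructor
  · intro hy
    obtain ⟨v, rfl⟩ := hG y
    refine ⟨v, ?_, rfl⟩
    by_cases hv : v = 0
    · simp [hv]
    have ha : IsAtom (φ (K ∙ v)) := (φ.isAtom_iff _).2 (nonzero_span_atom v hv)
    have heq := (ha.le_iff.1 ((span_singleton_le_iff_mem _ _).2 (hmem v))).resolve_left
      (by simpa using fun h0 => hv (hG0 v h0))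
    have hle : φ (K ∙ v) ≤ φ U := by
      rw [← heq]
      exact (span_singleton_le_iff_mem _ _).2 hy
    exact (span_singleton_le_iff_mem _ _).1 (φ.le_iff_le.1 hle)
  · rintro ⟨v, hv, rfl⟩
    exact φ.monotone ((span_singleton_le_iff_mem _ _).2 hv) (hmem v)

end Projective

theorem exists_vecMul_of_semilinearMap {F : Type*} [Field F] {n : Type*} [Fintype n]
    [DecidableEq n] (σ : F ≃+* F) (G : (n → F) →ₛₗ[(σ : F →+* F)] (n → F))
    (hG : Function.Injective G) :
    ∃ A : GL n F, ∀ v, G v = σ ∘ Matrix.vecMul v (A : Matrix n n F) := by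
  let T : (n → F) →ₗ[F] (n → F) :=
    { toFun := fun v => σ.symm ∘ G v
      map_add' := fun v w => by
        ext i
        simp
      map_smul' := fun a v => by
        ext i
        simp [map_smulₛₗ] }
  have hT : Function.Injective T := by
    intro v w hvw
    apply hG
    ext i
    exact σ.symm.injective (congrFun hvw i)
  have hu : IsUnit (LinearMap.toMatrix' T).transpose := by
    rw [Matrix.isUnit_transpose, ← Matrix.mulVec_injective_iff_isUnit]
    simpa [Function.Injective] using hT
  refine ⟨hu.unit, fun v => ?_⟩
  ext i
  simp [Matrix.vecMul_transpose, T]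

theorem le_iff_dS_add_finrank {F : Type*} [Field F] {n : Type*} [Fintype n]
    (U V : Submodule F (n → F)) :
    U ≤ V ↔ dS U V + Module.finrank F U = Module.finrank F V := by
  have h := Submodule.finrank_sup_add_finrank_inf_eq U V
  have hU := Submodule.finrank_mono (inf_le_left : U ⊓ V ≤ U)
  have hV := Submodule.finrank_mono (le_sup_right : V ≤ U ⊔ V)
  unfold dS
  constructor
  · intro hle
    rw [inf_eq_left.2 hle, sup_eq_right.2 hle]
    exact Nat.sub_add_cancel (Submodule.finrank_mono hle)
  · intro heq
    rw [← inf_eq_left]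
    exact Submodule.eq_of_le_of_finrank_le inf_le_left (by lia)

/-- For `n > 2`, every subspace-distance isometry of `PG(F,n)` preserving
dimensions is induced by a semilinear transformation: there are `A ∈ GL_n(F)`
and a ring automorphism `σ` of `F` with `ι(U) = { σ(v·A) : v ∈ U }` for all
subspaces `U` of `F^n`. -/
theorem stmt4 (F : Type*) [Field F] [Fintype F] (n : ℕ) (hn : 2 < n)
    (ι : Submodule F (Fin n → F) → Submodule F (Fin n → F))
    (hι : ∀ U V : Submodule F (Fin n → F), dS (ι U) (ι V) = dS U V)
    (hdim : ∀ U : Submodule F (Fin n → F),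
      Module.finrank F ↥(ι U) = Module.finrank F ↥U) :
    ∃ (A : GL (Fin n) F) (σ : F ≃+* F),
      ∀ U : Submodule F (Fin n → F),
        (ι U : Set (Fin n → F)) =
          (fun v => σ ∘ Matrix.vecMul v (A : Matrix (Fin n) (Fin n) F)) ''
            (U : Set (Fin n → F)) := by
  have hle : ∀ U V, ι U ≤ ι V ↔ U ≤ V := fun U V => by
    rw [le_iff_dS_add_finrank, le_iff_dS_add_finrank, hι, hdim, hdim]
  let emb : Submodule F (Fin n → F) ↪o Submodule F (Fin n → F) :=
    OrderEmbedding.ofMapLEIff ι hle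
  let φ : Submodule F (Fin n → F) ≃o Submodule F (Fin n → F) :=
    RelIso.ofSurjective emb (Finite.surjective_of_injective emb.injective)
  obtain ⟨σ, G, hG, hmem⟩ := φ.exists_semilinearMap (by simpa using hn)
  let τ : F ≃+* F := RingEquiv.ofBijective σ (Finite.injective_iff_bijective.1 σ.injective)
  obtain ⟨A, hA⟩ := exists_vecMul_of_semilinearMap τ G hG
  refine ⟨A, τ, fun U => ?_⟩
  rw [← funext hA]
  exact φ.coe_eq_image_of_mem (Finite.surjective_of_injective hG)
    ((injective_iff_map_eq_zero G).1 hG) hmem U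
end

section
/- Let F be a finite field and 1 ≤ k ≤ n. There exists a k-spread of F^n (a set S of k-dimensional F-subspaces of F^n such that any two distinct elements intersect only in the zero vector and every nonzero vector of F^n lies in some element of S) if and only if k divides n. -/
/-- If pairwise trivially intersecting `k`-dimensional subspaces cover a finite vector space of
dimension `n`, then `k ∣ n`, by counting nonzero vectors. -/
theorem dvd_finrank_of_spread {F V : Type*} [Field F] [Finite F] [AddCommGroup V] [Module F V]
    [Module.Finite F V] {k : ℕ} (S : Set (Submodule F V))
    (hdim : ∀ U ∈ S, Module.finrank F ↥U = k)
    (hdisj : ∀ U ∈ S, ∀ W ∈ S, U ≠ W → U ⊓ W = ⊥)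
    (hcov : ∀ v : V, v ≠ 0 → ∃ U ∈ S, v ∈ U) : k ∣ Module.finrank F V := by
  classical
  have : Finite V := Module.finite_of_finite F
  have : Fintype V := Fintype.ofFinite V
  have : Fintype S := Fintype.ofFinite S
  have hcover : (Finset.univ.erase (0 : V)) =
      S.toFinset.biUnion fun U ↦ (Finset.univ.filter (· ∈ U)).erase 0 := by
    ext v
    simp only [Finset.mem_erase, Finset.mem_univ, and_true, Finset.mem_biUnion, Set.mem_toFinset,
      Finset.mem_filter, true_and]
    exact ⟨fun hv ↦ (hcov v hv).imp fun U h ↦ ⟨h.1, hv, h.2⟩, fun ⟨_, _, hv, _⟩ ↦ hv⟩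
  have hcard : ∀ U ∈ S.toFinset, ((Finset.univ.filter (· ∈ U)).erase (0 : V)).card =
      Nat.card F ^ k - 1 := by
    intro U hU
    rw [Finset.card_erase_of_mem (by simp), ← Fintype.card_subtype, ← Nat.card_eq_fintype_card,
      ← hdim U (by simpa using hU)]
    exact congrArg (· - 1) (Module.natCard_eq_pow_finrank (K := F) (V := U))
  have hcount := congrArg Finset.card hcover
  rw [Finset.card_biUnion, Finset.sum_congr rfl hcard, Finset.card_erase_of_mem (by simp),
    Finset.card_univ, ← Nat.card_eq_fintype_card, Module.natCard_eq_pow_finrank (K := F),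
    Finset.sum_const, smul_eq_mul] at hcount
  · have hmod := Nat.pow_sub_one_mod_pow_sub_one (Nat.card F) k (Module.finrank F V)
    rw [hcount, Nat.mul_mod_left] at hmod
    refine Nat.dvd_of_mod_eq_zero (by_contra fun h ↦ ?_)
    have := Nat.one_lt_pow h (Finite.one_lt_card (α := F))
    omega
  · intro U hU W hW hUW
    rw [Function.onFun, Finset.disjoint_left]
    intro v hvU hvW
    simp only [Finset.mem_erase, Finset.mem_filter, Finset.mem_univ, true_and] at hvU hvW
    have hv : v ∈ U ⊓ W := ⟨hvU.2, hvW.2⟩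
    rw [hdisj U (by simpa using hU) W (by simpa using hW) hUW] at hv
    exact hvU.1 (by simpa using hv)

/-- The lines over an extension field `L / F`, seen in an `F`-space through an `F`-linear
equivalence, form a spread. -/
theorem exists_spread_of_linearEquiv {F L V W : Type*} [Field F] [Field L] [Algebra F L]
    [AddCommGroup V] [Module F V] [AddCommGroup W] [Module F W] [Module L W] [IsScalarTower F L W]
    (e : V ≃ₗ[F] W) :
    ∃ S : Set (Submodule F V),
      (∀ U ∈ S, Module.finrank F ↥U = Module.finrank F L) ∧
      (∀ U ∈ S, ∀ T ∈ S, U ≠ T → U ⊓ T = ⊥) ∧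
      (∀ v : V, v ≠ 0 → ∃ U ∈ S, v ∈ U) := by
  let line (w : W) : Submodule F V :=
    ((Submodule.span L {w}).restrictScalars F).comap (e : V →ₗ[F] W)
  have mem_line (w : W) (v : V) : v ∈ line w ↔ ∃ a : L, a • w = e v := by
    simp [line, Submodule.mem_span_singleton]
  have line_eq (w : W) (v : V) (hv : v ≠ 0) (h : v ∈ line w) : line (e v) = line w := by
    obtain ⟨a, ha⟩ := (mem_line w v).1 h
    have ha0 : a ≠ 0 := by
      rintro rfl
      exact hv (by simpa using ha.symm)
    simp only [line, ← ha, Submodule.span_singleton_smul_eq (IsUnit.mk0 a ha0)]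
  refine ⟨line '' {w | w ≠ 0}, ?_, ?_, fun v hv ↦ ?_⟩
  · rintro _ ⟨w, hw, rfl⟩
    have e₁ : line w ≃ₗ[F] (Submodule.span L {w}).restrictScalars F :=
      e.ofSubmodule' _
    exact (e₁.trans
      ((LinearEquiv.toSpanNonzeroSingleton L W w hw).symm.restrictScalars F)).finrank_eq
  · rintro _ ⟨w, -, rfl⟩ _ ⟨w', -, rfl⟩ hne
    refine (Submodule.eq_bot_iff _).2 fun v hv ↦ by_contra fun hv0 ↦ hne ?_
    rw [← line_eq w v hv0 hv.1, line_eq w' v hv0 hv.2]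
  · exact ⟨line (e v), ⟨e v, by simpa using hv, rfl⟩, (mem_line _ _).2 ⟨1, one_smul _ _⟩⟩

/-- A `k`-spread of `F^n` (a set of `k`-dimensional subspaces pairwise
intersecting trivially and covering all nonzero vectors) exists if and only
if `k` divides `n`. -/
theorem stmt7 (F : Type*) [Field F] [Fintype F] (k n : ℕ)
    (hk : 1 ≤ k) (hkn : k ≤ n) :
    (∃ S : Set (Submodule F (Fin n → F)),
      (∀ U ∈ S, Module.finrank F ↥U = k) ∧
      (∀ U ∈ S, ∀ V ∈ S, U ≠ V → U ⊓ V = ⊥) ∧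
      (∀ v : Fin n → F, v ≠ 0 → ∃ U ∈ S, v ∈ U)) ↔ k ∣ n := by
  constructor
  · rintro ⟨S, hdim, hdisj, hcov⟩
    simpa using dvd_finrank_of_spread S hdim hdisj hcov
  · rintro ⟨m, rfl⟩
    obtain ⟨p, _⟩ := CharP.exists F
    have : Fact p.Prime := ⟨CharP.char_is_prime F p⟩
    have : NeZero k := ⟨by omega⟩
    let L := FiniteField.Extension F p k
    have hL : Module.finrank F L = k := FiniteField.finrank_extension F p k
    have e : (Fin (k * m) → F) ≃ₗ[F] (Fin m → L) := LinearEquiv.ofFinrankEq _ _ <| by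
      rw [Module.finrank_fin_fun, Module.finrank_pi_fintype]
      simp [hL, mul_comm]
    simpa only [hL] using exists_spread_of_linearEquiv (L := L) e
end
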